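/- Let Assumption (M) hold. Then there exists a Borel probability measure μ* on 𝒳 such that for every Markov chain (X_t) with kernel Q whose initial law lies in 𝔓_b, the laws of X_t converge to μ* in total variation: ‖L(X_t) − μ*‖_TV → 0 as t → ∞. -/

import Mathlib

open MeasureTheory ProbabilityTheory Filter

/-- Total variation distance between two measures, defined as in the paper:
`‖μ − ν‖_TV = sup_{|φ|≤1} |∫ φ dμ − ∫ φ dν|`, the supremum running over
measurable functions `φ` bounded by `1` in absolute value. -/
noncomputable def tvDist {X : Type*} [MeasurableSpace X] (μ ν : Measure X) : ℝ :=
  ⨆ φ : {φ : X → ℝ // Measurable φ ∧ ∀ x, |φ x| ≤ 1},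
    |∫ x, φ.1 x ∂μ - ∫ x, φ.1 x ∂ν|

/-- If two probability measures differ by at most `r` on every measurable set, then their total
variation distance is at most `2 * r`. -/
theorem tvDist_le_two_mul {X : Type*} [MeasurableSpace X] {μ ν : Measure X}
    [IsProbabilityMeasure μ] [IsProbabilityMeasure ν] {r : ℝ}
    (h : ∀ A, MeasurableSet A → |μ.real A - ν.real A| ≤ r) : tvDist μ ν ≤ 2 * r := by
  have hr : 0 ≤ r := (abs_nonneg _).trans (h ∅ MeasurableSet.empty)
  refine Real.iSup_le ?_ (by positivity)
  rintro ⟨φ, hφ, hb⟩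
  have layercake : ∀ (ρ : Measure X) [IsProbabilityMeasure ρ],
      IntegrableOn (fun t => ρ.real {a | t ≤ φ a + 1}) (Set.Ioc 0 2) ∧
        ∫ x, φ x ∂ρ = (∫ t in Set.Ioc (0 : ℝ) 2, ρ.real {a | t ≤ φ a + 1}) - 1 := by
    intro ρ _
    have hint : Integrable φ ρ :=
      .of_bound hφ.aestronglyMeasurable 1 (ae_of_all _ fun x => by simpa using hb x)
    constructor
    · have hanti : Antitone fun t : ℝ => ρ.real {a | t ≤ φ a + 1} := fun s t hst =>
        measureReal_mono fun a (ha : t ≤ φ a + 1) => hst.trans ha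
      exact Measure.integrableOn_of_bounded (M := 1) (by simp) hanti.measurable.aestronglyMeasurable
        (ae_of_all _ fun t => by
          rw [Real.norm_of_nonneg measureReal_nonneg]
          exact measureReal_le_one)
    · have key := (hint.add (integrable_const (1 : ℝ))).integral_eq_integral_Ioc_meas_le (M := 2)
        (ae_of_all _ fun x => by
          have := (abs_le.1 (hb x)).1
          simp only [Pi.zero_apply, Pi.add_apply]; linarith)
        (ae_of_all _ fun x => by
          have := (abs_le.1 (hb x)).2
          simp only [Pi.add_apply]; linarith)
      simp only [Pi.add_apply] at key
      rw [integral_add hint (integrable_const _)] at key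
      simp only [integral_const, probReal_univ, smul_eq_mul, mul_one] at key
      linarith
  obtain ⟨hμi, hμ⟩ := layercake μ
  obtain ⟨hνi, hν⟩ := layercake ν
  simp only
  rw [hμ, hν, sub_sub_sub_cancel_right, ← integral_sub hμi hνi]
  have hle := norm_setIntegral_le_of_norm_le_const (μ := (volume : Measure ℝ))
    (s := Set.Ioc (0 : ℝ) 2) (C := r)
    (f := fun t => μ.real {a | t ≤ φ a + 1} - ν.real {a | t ≤ φ a + 1}) (by simp)
    fun t _ => h _ (measurableSet_le measurable_const (hφ.add_const 1))
  simpa [mul_comm] using hle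

/-- A sequence of probability measures that is Cauchy uniformly over measurable sets converges,
uniformly over measurable sets, to a probability measure. -/
theorem exists_limit_of_uniform_cauchy {X : Type*} [MeasurableSpace X] (μ : ℕ → Measure X)
    [∀ t, IsProbabilityMeasure (μ t)]
    (hC : ∀ ε > 0, ∃ N, ∀ m ≥ N, ∀ n ≥ N, ∀ A, MeasurableSet A →
      |(μ m).real A - (μ n).real A| ≤ ε) :
    ∃ μ' : Measure X, IsProbabilityMeasure μ' ∧ ∀ ε > 0, ∃ N, ∀ n ≥ N, ∀ A, MeasurableSet A →
      |(μ n).real A - μ'.real A| ≤ ε := by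
  have hlim : ∀ A, MeasurableSet A → ∃ l, Tendsto (fun t => (μ t).real A) atTop (nhds l) := by
    intro A hA
    refine cauchySeq_tendsto_of_complete (Metric.cauchySeq_iff.2 fun ε hε => ?_)
    obtain ⟨N, hN⟩ := hC (ε / 2) (half_pos hε)
    exact ⟨N, fun m hm n hn => (hN m hm n hn A hA).trans_lt (half_lt_self hε)⟩
  choose! l hl using hlim
  have hl0 : ∀ A, MeasurableSet A → 0 ≤ l A := fun A hA =>
    ge_of_tendsto' (hl A hA) fun _ => measureReal_nonneg
  have hunif : ∀ ε > 0, ∃ N, ∀ n ≥ N, ∀ A, MeasurableSet A → |(μ n).real A - l A| ≤ ε := by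
    intro ε hε
    obtain ⟨N, hN⟩ := hC ε hε
    refine ⟨N, fun n hn A hA => ?_⟩
    refine le_of_tendsto ((tendsto_const_nhds.sub (hl A hA)).abs) ?_
    filter_upwards [eventually_ge_atTop N] with m hm using hN n hn m hm A hA
  have hsum : ∀ f : ℕ → Set X, (∀ i, MeasurableSet (f i)) → Pairwise (Function.onFun Disjoint f) →
      HasSum (fun i => l (f i)) (l (⋃ i, f i)) := by
    intro f hf hd
    rw [hasSum_iff_tendsto_nat_of_nonneg fun i => hl0 _ (hf i)]
    have hfin : ∀ n, ∑ i ∈ Finset.range n, l (f i) = l (⋃ i ∈ Finset.range n, f i) := by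
      intro n
      refine tendsto_nhds_unique (tendsto_finsetSum _ fun i _ => hl _ (hf i)) ?_
      refine (hl _ (Finset.measurableSet_biUnion _ fun i _ => hf i)).congr fun t => ?_
      exact measureReal_biUnion_finset (fun i _ j _ hij => hd hij) fun i _ => hf i
    rw [Metric.tendsto_atTop]
    intro ε hε
    obtain ⟨N, hN⟩ := hunif (ε / 4) (by positivity)
    have htail : Tendsto (fun n => ∑ i ∈ Finset.range n, (μ N).real (f i)) atTop
        (nhds ((μ N).real (⋃ i, f i))) := by
      refine HasSum.tendsto_sum_nat ?_
      have hfinite : ∑' i, μ N (f i) ≠ ⊤ := measure_iUnion (μ := μ N) hd hf ▸ measure_ne_top _ _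
      rw [measureReal_def, measure_iUnion hd hf,
        ENNReal.tsum_toReal_eq fun i => measure_ne_top _ _]
      exact ENNReal.hasSum_toReal hfinite
    obtain ⟨n₀, hn₀⟩ := Metric.tendsto_atTop.1 htail (ε / 4) (by positivity)
    refine ⟨n₀, fun n hn => ?_⟩
    have h1 := hn₀ n hn
    rw [← measureReal_biUnion_finset (fun i _ j _ hij => hd hij) fun i _ => hf i] at h1
    have h2 := hN N le_rfl _ (MeasurableSet.iUnion hf)
    have h3 := hN N le_rfl _ (Finset.measurableSet_biUnion (Finset.range n) fun i _ => hf i)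
    rw [hfin, Real.dist_eq, abs_lt]
    rw [Real.dist_eq, abs_lt] at h1
    rw [abs_le] at h2 h3
    constructor <;> linarith [h1.1, h1.2, h2.1, h2.2, h3.1, h3.2]
  have hempty : l ∅ = 0 :=
    tendsto_nhds_unique (hl ∅ MeasurableSet.empty) (by simp)
  let μ' : Measure X := Measure.ofMeasurable (fun A _ => ENNReal.ofReal (l A)) (by simp [hempty])
    fun f hf hd => by
      have := hsum f hf hd
      rw [← this.tsum_eq, ENNReal.ofReal_tsum_of_nonneg (fun i => hl0 _ (hf i)) this.summable]
  have hμ' : ∀ A, MeasurableSet A → μ' A = ENNReal.ofReal (l A) := fun A hA =>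
    Measure.ofMeasurable_apply A hA
  refine ⟨μ', ⟨?_⟩, fun ε hε => ?_⟩
  · rw [hμ' _ MeasurableSet.univ,
      tendsto_nhds_unique (hl Set.univ MeasurableSet.univ) (b := 1) (by simp), ENNReal.ofReal_one]
  · obtain ⟨N, hN⟩ := hunif ε hε
    refine ⟨N, fun n hn A hA => ?_⟩
    rw [measureReal_def μ', hμ' A hA, ENNReal.toReal_ofReal (hl0 A hA)]
    exact hN n hn A hA

theorem bind_kernel_add {X : Type*} [MeasurableSpace X] (Q : Kernel X X) (κ η : Measure X) :
    (κ + η).bind (fun x => Q x) = κ.bind (fun x => Q x) + η.bind (fun x => Q x) := by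
  ext A hA
  simp only [Measure.add_apply, Measure.bind_apply hA Q.measurable.aemeasurable,
    lintegral_add_measure]

theorem bind_kernel_univ {X : Type*} [MeasurableSpace X] (Q : Kernel X X) [IsMarkovKernel Q]
    (η : Measure X) : η.bind (fun x => Q x) Set.univ = η Set.univ := by
  simp [Measure.bind_apply MeasurableSet.univ Q.measurable.aemeasurable]

/-- Pushing a measure with mass at least `ofReal b` on the minorization set through the kernel gives
a measure dominating `ofReal (a * b) • ν`. -/
theorem smul_le_bind_of_minorization {X : Type*} [MeasurableSpace X] (Q : Kernel X X) {S : Set X}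
    (hS : MeasurableSet S) {a b : ℝ} (ha : 0 ≤ a) {ν : Measure X}
    (hminor : ∀ x ∈ S, ∀ A, MeasurableSet A → ENNReal.ofReal a * ν A ≤ Q x A)
    {η : Measure X} (hη : ENNReal.ofReal b ≤ η S) :
    ENNReal.ofReal (a * b) • ν ≤ η.bind (fun x => Q x) := by
  refine Measure.le_intro fun A hA _ => ?_
  rw [Measure.bind_apply hA Q.measurable.aemeasurable, Measure.smul_apply, smul_eq_mul,
    ENNReal.ofReal_mul ha]
  calc ENNReal.ofReal a * ENNReal.ofReal b * ν A
      = ENNReal.ofReal a * ν A * ENNReal.ofReal b := by ring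
    _ ≤ ENNReal.ofReal a * ν A * η S := by gcongr
    _ = ∫⁻ _ in S, ENNReal.ofReal a * ν A ∂η := by simp
    _ ≤ ∫⁻ x in S, Q x A ∂η := setLIntegral_mono' hS fun x hx => hminor x hx A hA
    _ ≤ ∫⁻ x, Q x A ∂η := setLIntegral_le_lintegral _ _

/-- Two chains which both stay in the minorization set `S` with probability at least `1 - ε` have
at time `t` a common part of mass at least `1 - (1 - a) ^ t - ε`. -/
theorem exists_common_part {X : Type*} [MeasurableSpace X] (Q : Kernel X X) [IsMarkovKernel Q]
    {S : Set X} (hS : MeasurableSet S) {a ε : ℝ} (ha : a ∈ Set.Ioc (0 : ℝ) 1) (hε : 0 ≤ ε)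
    {ν : Measure X} [IsProbabilityMeasure ν]
    (hminor : ∀ x ∈ S, ∀ A, MeasurableSet A → ENNReal.ofReal a * ν A ≤ Q x A)
    {μ₁ μ₂ : ℕ → Measure X} [∀ t, IsProbabilityMeasure (μ₁ t)] [∀ t, IsProbabilityMeasure (μ₂ t)]
    (h₁ : ∀ t, μ₁ (t + 1) = (μ₁ t).bind (fun x => Q x))
    (h₂ : ∀ t, μ₂ (t + 1) = (μ₂ t).bind (fun x => Q x))
    (hS₁ : ∀ t, (μ₁ t).real Sᶜ ≤ ε) (hS₂ : ∀ t, (μ₂ t).real Sᶜ ≤ ε) (t : ℕ) :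
    ∃ κ η₁ η₂ : Measure X, μ₁ t = κ + η₁ ∧ μ₂ t = κ + η₂ ∧
      η₁ Set.univ = η₂ Set.univ ∧ η₁.real Set.univ ≤ (1 - a) ^ t + ε := by
  induction t with
  | zero => exact ⟨0, μ₁ 0, μ₂ 0, by simp, by simp, by simp, by simpa using hε⟩
  | succ t ih =>
    obtain ⟨κ, η₁, η₂, e₁, e₂, hmass, hle⟩ := ih
    have mass_on_S : ∀ {μ η : Measure X} [IsProbabilityMeasure μ], μ = κ + η → μ.real Sᶜ ≤ ε →
        ENNReal.ofReal (max (η.real Set.univ - ε) 0) ≤ η S := by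
      intro μ η _ hμ hSc
      have hημ : η ≤ μ := hμ ▸ Measure.le_add_left le_rfl
      have : IsFiniteMeasure η := isFiniteMeasure_of_le μ hημ
      have hηSc : η.real Sᶜ ≤ μ.real Sᶜ := ENNReal.toReal_mono (by finiteness) (hημ _)
      rw [← ofReal_measureReal (μ := η) (s := S)]
      refine ENNReal.ofReal_le_ofReal (max_le ?_ measureReal_nonneg)
      linarith [measureReal_add_measureReal_compl (μ := η) hS]
    have hreal : η₂.real Set.univ = η₁.real Set.univ := by simp only [measureReal_def, hmass]
    set r := η₁.real Set.univ with hr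
    set c := a * max (r - ε) 0 with hc
    have d₁ : ENNReal.ofReal c • ν ≤ η₁.bind (fun x => Q x) :=
      smul_le_bind_of_minorization Q hS ha.1.le hminor (mass_on_S e₁ (hS₁ t))
    have d₂ : ENNReal.ofReal c • ν ≤ η₂.bind (fun x => Q x) :=
      smul_le_bind_of_minorization Q hS ha.1.le hminor (hreal ▸ mass_on_S e₂ (hS₂ t))
    have : IsFiniteMeasure (ENNReal.ofReal c • ν) := ν.smul_finite (by finiteness)
    have : IsFiniteMeasure η₁ :=
      isFiniteMeasure_of_le (μ₁ t) (e₁ ▸ Measure.le_add_left le_rfl)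
    have m₁ := Measure.sub_apply MeasurableSet.univ d₁
    have m₂ := Measure.sub_apply MeasurableSet.univ d₂
    rw [bind_kernel_univ] at m₁ m₂
    refine ⟨κ.bind (fun x => Q x) + ENNReal.ofReal c • ν,
      η₁.bind (fun x => Q x) - ENNReal.ofReal c • ν,
      η₂.bind (fun x => Q x) - ENNReal.ofReal c • ν, ?_, ?_, ?_, ?_⟩
    · rw [h₁, e₁, bind_kernel_add, add_assoc, add_comm (_ • ν), Measure.sub_add_cancel_of_le d₁]
    · rw [h₂, e₂, bind_kernel_add, add_assoc, add_comm (_ • ν), Measure.sub_add_cancel_of_le d₂]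
    · rw [m₁, m₂, hmass]
    · have hc0 : 0 ≤ c := mul_nonneg ha.1.le (le_max_right _ _)
      have hcr := d₁ Set.univ
      rw [bind_kernel_univ] at hcr
      rw [measureReal_def, m₁, ENNReal.toReal_sub_of_le hcr (by finiteness)]
      have hcν : ((ENNReal.ofReal c • ν) Set.univ).toReal = c := by
        simp [ENNReal.toReal_ofReal hc0]
      rw [hcν, ← measureReal_def, ← hr, pow_succ]
      have hp : 0 ≤ (1 - a) ^ t := pow_nonneg (by linarith [ha.2]) t
      rcases le_total (r - ε) 0 with h | h
      · rw [hc, max_eq_right h]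
        nlinarith [mul_nonneg hp (sub_nonneg.2 ha.2)]
      · rw [hc, max_eq_left h]
        nlinarith [mul_nonneg (sub_nonneg.2 hle) (sub_nonneg.2 ha.2)]

theorem abs_measureReal_sub_le {X : Type*} [MeasurableSpace X] (Q : Kernel X X) [IsMarkovKernel Q]
    {S : Set X} (hS : MeasurableSet S) {a ε : ℝ} (ha : a ∈ Set.Ioc (0 : ℝ) 1) (hε : 0 ≤ ε)
    {ν : Measure X} [IsProbabilityMeasure ν]
    (hminor : ∀ x ∈ S, ∀ A, MeasurableSet A → ENNReal.ofReal a * ν A ≤ Q x A)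
    {μ₁ μ₂ : ℕ → Measure X} [∀ t, IsProbabilityMeasure (μ₁ t)] [∀ t, IsProbabilityMeasure (μ₂ t)]
    (h₁ : ∀ t, μ₁ (t + 1) = (μ₁ t).bind (fun x => Q x))
    (h₂ : ∀ t, μ₂ (t + 1) = (μ₂ t).bind (fun x => Q x))
    (hS₁ : ∀ t, (μ₁ t).real Sᶜ ≤ ε) (hS₂ : ∀ t, (μ₂ t).real Sᶜ ≤ ε) (t : ℕ) (A : Set X) :
    |(μ₁ t).real A - (μ₂ t).real A| ≤ (1 - a) ^ t + ε := by
  obtain ⟨κ, η₁, η₂, e₁, e₂, hmass, hle⟩ :=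
    exists_common_part Q hS ha hε hminor h₁ h₂ hS₁ hS₂ t
  have : IsFiniteMeasure κ := isFiniteMeasure_of_le (μ₁ t) (e₁ ▸ Measure.le_add_right le_rfl)
  have : IsFiniteMeasure η₁ := isFiniteMeasure_of_le (μ₁ t) (e₁ ▸ Measure.le_add_left le_rfl)
  have : IsFiniteMeasure η₂ := isFiniteMeasure_of_le (μ₂ t) (e₂ ▸ Measure.le_add_left le_rfl)
  have b₁ : η₁.real A ≤ η₁.real Set.univ := measureReal_mono (Set.subset_univ A)
  have b₂ : η₂.real A ≤ η₂.real Set.univ := measureReal_mono (Set.subset_univ A)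
  have hreal : η₂.real Set.univ = η₁.real Set.univ := by simp only [measureReal_def, hmass]
  have p₁ : 0 ≤ η₁.real A := measureReal_nonneg
  have p₂ : 0 ≤ η₂.real A := measureReal_nonneg
  rw [e₁, e₂, measureReal_add_apply, measureReal_add_apply, abs_le]
  constructor <;> linarith

/-- Any two chains that are bounded in probability merge, at a rate that is uniform over all time
shifts of the chains. -/
theorem exists_forall_shift_abs_measureReal_sub_le {X : Type*} [MeasurableSpace X]
    (Q : Kernel X X) [IsMarkovKernel Q]
    {S : ℕ → Set X} (hS : ∀ n, MeasurableSet (S n))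
    {a : ℕ → ℝ} (ha : ∀ n, a n ∈ Set.Ioc (0 : ℝ) 1)
    {ν : ℕ → Measure X} [∀ n, IsProbabilityMeasure (ν n)]
    (hminor : ∀ n, ∀ x ∈ S n, ∀ A, MeasurableSet A → ENNReal.ofReal (a n) * ν n A ≤ Q x A)
    {μ₁ μ₂ : ℕ → Measure X} [∀ t, IsProbabilityMeasure (μ₁ t)] [∀ t, IsProbabilityMeasure (μ₂ t)]
    (h₁ : ∀ t, μ₁ (t + 1) = (μ₁ t).bind (fun x => Q x))
    (h₂ : ∀ t, μ₂ (t + 1) = (μ₂ t).bind (fun x => Q x))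
    (hS₁ : Tendsto (fun n => ⨆ t, μ₁ t (S n)ᶜ) atTop (nhds 0))
    (hS₂ : Tendsto (fun n => ⨆ t, μ₂ t (S n)ᶜ) atTop (nhds 0)) {ε : ℝ} (hε : 0 < ε) :
    ∃ N, ∀ t ≥ N, ∀ s₁ s₂ A, |(μ₁ (t + s₁)).real A - (μ₂ (t + s₂)).real A| ≤ ε := by
  have hpos : 0 < ENNReal.ofReal (ε / 2) := ENNReal.ofReal_pos.2 (half_pos hε)
  obtain ⟨n, hn₁, hn₂⟩ :=
    ((hS₁.eventually (gt_mem_nhds hpos)).and (hS₂.eventually (gt_mem_nhds hpos))).exists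
  have hpow : Tendsto (fun t => (1 - a n) ^ t) atTop (nhds 0) :=
    tendsto_pow_atTop_nhds_zero_of_lt_one (by linarith [(ha n).2]) (by linarith [(ha n).1])
  obtain ⟨N, hN⟩ := eventually_atTop.1 (hpow.eventually (gt_mem_nhds (half_pos hε)))
  refine ⟨N, fun t ht s₁ s₂ A => ?_⟩
  have key := abs_measureReal_sub_le Q (hS n) (ha n) (half_pos hε).le (hminor n)
    (μ₁ := fun t => μ₁ (t + s₁)) (μ₂ := fun t => μ₂ (t + s₂))
    (fun t => by rw [← h₁, add_right_comm]) (fun t => by rw [← h₂, add_right_comm])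
    (fun t => ENNReal.toReal_le_of_le_ofReal (half_pos hε).le
      ((le_iSup (fun t => μ₁ t (S n)ᶜ) (t + s₁)).trans hn₁.le))
    (fun t => ENNReal.toReal_le_of_le_ofReal (half_pos hε).le
      ((le_iSup (fun t => μ₂ t (S n)ᶜ) (t + s₂)).trans hn₂.le)) t A
  linarith [hN t ht]

theorem exists_invariant_limit_TV
    {𝒳 : Type*} [MeasurableSpace 𝒳] [TopologicalSpace 𝒳] [PolishSpace 𝒳] [BorelSpace 𝒳]
    (Q : Kernel 𝒳 𝒳) [IsMarkovKernel Q]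
    (Xs : ℕ → Set 𝒳) (hXsmeas : ∀ n, MeasurableSet (Xs n)) (hXsmono : Monotone Xs)
    (hXs0 : (Xs 0).Nonempty)
    -- Assumption (M): minorization on each 𝒳ₙ
    (α : ℕ → ℝ) (hα : ∀ n, α n ∈ Set.Ioc (0:ℝ) 1) (hαanti : Antitone α)
    (ν : ℕ → Measure 𝒳) (hν : ∀ n, IsProbabilityMeasure (ν n))
    (hminor : ∀ n, ∀ x ∈ Xs n, ∀ A : Set 𝒳, MeasurableSet A →
      ENNReal.ofReal (α n) * ν n A ≤ Q x A) :
    ∃ μstar : Measure 𝒳, IsProbabilityMeasure μstar ∧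
      ∀ μ : ℕ → Measure 𝒳,
        (∀ t, IsProbabilityMeasure (μ t)) →
        -- (μ t) are the marginal laws of a Markov chain with kernel Q
        (∀ t, μ (t + 1) = (μ t).bind (fun x => Q x)) →
        -- the initial law lies in 𝔓_b
        Tendsto (fun n => ⨆ t, μ t (Xs n)ᶜ) atTop (nhds 0) →
        Tendsto (fun t => tvDist (μ t) μstar) atTop (nhds 0) := by
  by_cases hex : ∃ μ : ℕ → Measure 𝒳, (∀ t, IsProbabilityMeasure (μ t)) ∧
      (∀ t, μ (t + 1) = (μ t).bind (fun x => Q x)) ∧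
      Tendsto (fun n => ⨆ t, μ t (Xs n)ᶜ) atTop (nhds 0)
  · obtain ⟨μ₀, hprob₀, hchain₀, hbdd₀⟩ := hex
    obtain ⟨μstar, hstar, hlim⟩ := exists_limit_of_uniform_cauchy μ₀ fun ε hε => by
      obtain ⟨N, hN⟩ := exists_forall_shift_abs_measureReal_sub_le Q hXsmeas hα hminor
        hchain₀ hchain₀ hbdd₀ hbdd₀ hε
      refine ⟨N, fun m hm n hn A _ => ?_⟩
      simpa [Nat.add_sub_cancel' hm, Nat.add_sub_cancel' hn] using
        hN N le_rfl (m - N) (n - N) A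
    refine ⟨μstar, hstar, fun μ hprob hchain hbdd => ?_⟩
    rw [Metric.tendsto_atTop]
    intro ε hε
    obtain ⟨N₁, hN₁⟩ := exists_forall_shift_abs_measureReal_sub_le Q hXsmeas hα hminor
      hchain hchain₀ hbdd hbdd₀ (show 0 < ε / 8 by positivity)
    obtain ⟨N₂, hN₂⟩ := hlim (ε / 8) (by positivity)
    refine ⟨max N₁ N₂, fun t ht => ?_⟩
    have hle : tvDist (μ t) μstar ≤ 2 * (ε / 8 + ε / 8) :=
      tvDist_le_two_mul fun A hA => (abs_sub_le _ ((μ₀ t).real A) _).trans <|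
        add_le_add (hN₁ t (le_of_max_le_left ht) 0 0 A) (hN₂ t (le_of_max_le_right ht) A hA)
    have hnonneg : 0 ≤ tvDist (μ t) μstar := Real.iSup_nonneg fun _ => abs_nonneg _
    rw [Real.dist_eq, sub_zero, abs_of_nonneg hnonneg]
    linarith
  · exact ⟨ν 0, hν 0, fun μ h₁ h₂ h₃ => absurd ⟨μ, h₁, h₂, h₃⟩ hex⟩
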